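/- arXiv:2405.05932 — 9 statements merged into one kernel-verified Lean document; each statement's English description precedes it below -/
import Mathlib

section
/- Let Λ be a unimodular lattice, let L ⊆ Λ be a primitive sublattice on which the bilinear form is nondegenerate, and let T = L^⊥ be its orthogonal complement in Λ. If φ is an isometry of L that acts trivially on the discriminant group A_L, then there exists an isometry Φ of Λ such that Φ restricted to L equals φ and Φ restricted to T is the identity. -/
open TensorProduct

lemma bilinForm_zsmul_left {M : Type*} [AddCommGroup M] [Module ℤ M]
    (B : LinearMap.BilinForm ℤ M) (n : ℤ) (x y : M) : B (n • x) y = n * B x y := by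
  simp

/-- A functional on a lattice with nondegenerate form is represented by the form up to a
nonzero integer multiple. -/
lemma exists_smul_dual_eq {L : Type*} [AddCommGroup L] [Module ℤ L] [Module.Free ℤ L]
    [Module.Finite ℤ L] (B : LinearMap.BilinForm ℤ L)
    (hB : ∀ x : L, (∀ y : L, B x y = 0) → x = 0) (f : L →ₗ[ℤ] ℤ) :
    ∃ d : ℤ, d ≠ 0 ∧ ∃ a : L, ∀ y, B a y = d * f y := by
  classical
  let b := Module.Free.chooseBasis ℤ L
  let M := LinearMap.BilinForm.toMatrix b B
  have hcoord (c : Module.Free.ChooseBasisIndex ℤ L → ℤ) (j) :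
      B (b.equivFun.symm c) (b j) = Matrix.vecMul c M j := by
    simp [M, Module.Basis.equivFun_symm_apply, Matrix.vecMul, dotProduct, LinearMap.BilinForm.toMatrix_apply]
  have hdet : M.det ≠ 0 := by
    intro h
    obtain ⟨c, hc, hc0⟩ := Matrix.exists_vecMul_eq_zero_iff.mpr h
    have hsum : b.equivFun.symm c = 0 := by
      refine hB _ fun y => ?_
      have : B (b.equivFun.symm c) = 0 := b.ext fun j => by rw [hcoord, hc0]; rfl
      rw [this]; rfl
    exact hc ((LinearEquiv.map_eq_zero_iff _).mp hsum)
  refine ⟨M.det, hdet, b.equivFun.symm (Matrix.vecMul (fun i => f (b i)) M.adjugate), fun y => ?_⟩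
  have : B (b.equivFun.symm (Matrix.vecMul (fun i => f (b i)) M.adjugate)) = M.det • f :=
    b.ext fun j => by
      rw [hcoord, Matrix.vecMul_vecMul, Matrix.adjugate_mul, Matrix.vecMul_smul,
        Matrix.vecMul_one]
      rfl
  rw [this]; rfl

/-- If `φ` acts trivially on the discriminant group and `d⁻¹ a` lies in the dual lattice, then
`φ a - a` is divisible by `d`. -/
lemma exists_smul_eq_sub_of_trivial_on_discriminant {L : Type*} [AddCommGroup L] [Module ℤ L]
    (B : LinearMap.BilinForm ℤ L) (hB : ∀ x : L, (∀ y : L, B x y = 0) → x = 0)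
    (φ : L →ₗ[ℤ] L)
    (hdisc : ∀ x : ℚ ⊗[ℤ] L,
      (∀ y : L, ∃ n : ℤ, LinearMap.BilinForm.baseChange ℚ B x ((1 : ℚ) ⊗ₜ[ℤ] y) = (n : ℚ)) →
      ∃ z : L, LinearMap.baseChange ℚ φ x - x = (1 : ℚ) ⊗ₜ[ℤ] z)
    {d : ℤ} (hd : d ≠ 0) {a : L} (ha : ∀ y, d ∣ B a y) :
    ∃ z : L, φ a - a = d • z := by
  have hd' : (d : ℚ) ≠ 0 := Int.cast_ne_zero.mpr hd
  obtain ⟨z, hz⟩ := hdisc ((d : ℚ)⁻¹ ⊗ₜ[ℤ] a) fun y => by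
    obtain ⟨n, hn⟩ := ha y
    refine ⟨n, ?_⟩
    simp [LinearMap.BilinForm.baseChange_tmul, hn]
    field_simp
  refine ⟨z, sub_eq_zero.mp (hB _ fun y => ?_)⟩
  have h := congrArg
    (fun x => LinearMap.BilinForm.baseChange ℚ B x ((1 : ℚ) ⊗ₜ[ℤ] y)) hz
  simp only [LinearMap.baseChange_tmul, ← TensorProduct.tmul_sub,
    LinearMap.BilinForm.baseChange_tmul] at h
  have h' : ((B (φ a - a) y : ℤ) : ℚ) = (d * B z y : ℤ) := by
    simp at h ⊢
    field_simp at h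
    linarith
  have h'' : B (φ a - a) y = d * B z y := by exact_mod_cast h'
  rw [map_sub, LinearMap.sub_apply, h'', bilinForm_zsmul_left, sub_self]

/-- Let `Λ` be a unimodular lattice, `L ⊆ Λ` a primitive sublattice
(realized here as an injective isometric embedding `ι : L → Λ` with torsion-free cokernel)
on which the bilinear form is nondegenerate, and `T = L^⊥`. If `φ` is an isometry of `L`
acting trivially on the discriminant group `A_L` (i.e. for every `x` in the dual lattice
`L^∨ ⊆ L ⊗ ℚ`, the ℚ-linear extension of `φ` satisfies `φ(x) - x ∈ L`), then `φ` extends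
to an isometry `Φ` of `Λ` restricting to the identity on `T`. -/
theorem stmt_0
    (Λ L : Type) [AddCommGroup Λ] [Module ℤ Λ] [Module.Free ℤ Λ] [Module.Finite ℤ Λ]
    [AddCommGroup L] [Module ℤ L] [Module.Free ℤ L] [Module.Finite ℤ L]
    (BΛ : LinearMap.BilinForm ℤ Λ) (BL : LinearMap.BilinForm ℤ L)
    -- the form on Λ is symmetric and nondegenerate
    (hsymm : ∀ x y, BΛ x y = BΛ y x)
    (hnd : ∀ x, (∀ y, BΛ x y = 0) → x = 0)
    -- Λ is unimodular: x ↦ (x, ·) is a bijection Λ → Hom(Λ, ℤ)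
    (hunimod : Function.Bijective (fun x : Λ => BΛ x))
    -- ι : L → Λ is an isometric embedding
    (ι : L →ₗ[ℤ] Λ)
    (hinj : Function.Injective ι)
    (hiso : ∀ x y, BΛ (ι x) (ι y) = BL x y)
    -- the sublattice L is primitive in Λ (torsion-free cokernel)
    (hprim : ∀ (x : Λ) (n : ℤ), n ≠ 0 → n • x ∈ LinearMap.range ι →
      x ∈ LinearMap.range ι)
    -- the bilinear form is nondegenerate on L
    (hLnd : ∀ x : L, (∀ y : L, BL x y = 0) → x = 0)
    -- T = L^⊥, the orthogonal complement of L in Λ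
    (T : Submodule ℤ Λ)
    (hT : ∀ x, x ∈ T ↔ ∀ y : L, BΛ x (ι y) = 0)
    -- φ is an isometry of L
    (φ : L ≃ₗ[ℤ] L)
    (hφ : ∀ x y, BL (φ x) (φ y) = BL x y)
    -- φ acts trivially on the discriminant group A_L = L^∨/L
    (hdisc : ∀ x : ℚ ⊗[ℤ] L,
      (∀ y : L, ∃ n : ℤ, LinearMap.BilinForm.baseChange ℚ BL x ((1 : ℚ) ⊗ₜ[ℤ] y) = (n : ℚ)) →
      ∃ z : L, LinearMap.baseChange ℚ (φ : L →ₗ[ℤ] L) x - x = (1 : ℚ) ⊗ₜ[ℤ] z) :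
    -- conclusion: φ extends to an isometry Φ of Λ which is the identity on T
    ∃ Φ : Λ ≃ₗ[ℤ] Λ, (∀ x y, BΛ (Φ x) (Φ y) = BΛ x y) ∧
      (∀ x : L, Φ (ι x) = ι (φ x)) ∧ (∀ t ∈ T, Φ t = t) := by
  have key (v : Λ) : ∃ z : L, ∃ d : ℤ, d ≠ 0 ∧ ∃ a : L,
      (∀ y, BL a y = d * BΛ v (ι y)) ∧ φ a - a = d • z := by
    obtain ⟨d, hd, a, ha⟩ := exists_smul_dual_eq BL hLnd ((BΛ v).comp ι)
    obtain ⟨z, hz⟩ := exists_smul_eq_sub_of_trivial_on_discriminant BL hLnd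
      (φ : L →ₗ[ℤ] L) hdisc hd (a := a) fun y => ⟨_, ha y⟩
    exact ⟨z, d, hd, a, ha, hz⟩
  choose z d hd a ha hz using key
  have z_spec (v : Λ) (y : L) : BL (z v) (φ y) = BΛ v (ι y) - BΛ v (ι (φ y)) := by
    refine mul_left_cancel₀ (hd v) ?_
    calc d v * BL (z v) (φ y) = BL (d v • z v) (φ y) := (bilinForm_zsmul_left ..).symm
      _ = d v * (BΛ v (ι y) - BΛ v (ι (φ y))) := by
          rw [← hz, map_sub, LinearMap.sub_apply, hφ, ha, ha, mul_sub]
  have z_unique (v : Λ) (x : L)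
      (hx : ∀ y, BL x (φ y) = BΛ v (ι y) - BΛ v (ι (φ y))) : z v = x := by
    refine sub_eq_zero.mp (hLnd _ fun y => ?_)
    obtain ⟨y, rfl⟩ := φ.surjective y
    rw [map_sub, LinearMap.sub_apply, z_spec, hx, sub_self]
  let Z : Λ →ₗ[ℤ] L :=
    { toFun := z
      map_add' := fun v w => z_unique _ _ fun y => by
        simp only [map_add, LinearMap.add_apply, z_spec]; ring
      map_smul' := fun n v => z_unique _ _ fun y => by
        simp only [map_smul, LinearMap.smul_apply, z_spec, smul_eq_mul, RingHom.id_apply]; ring }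
  let F : Λ →ₗ[ℤ] Λ := LinearMap.id + ι ∘ₗ Z
  have F_apply (v : Λ) : F v = v + ι (z v) := rfl
  have F_isometry (v w : Λ) : BΛ (F v) (F w) = BΛ v w := by
    have cross : BΛ v (ι (z w)) + BΛ w (ι (z v)) + BL (z v) (z w) = 0 := by
      obtain ⟨y, hy⟩ := φ.surjective (z w)
      have h₁ : BL (z v) (z w) = BΛ v (ι y) - BΛ v (ι (z w)) := by rw [← hy, z_spec]
      have h₂ : d v * BΛ v (ι y) = - (d v * BΛ w (ι (z v))) := by
        calc d v * BΛ v (ι y) = BL (z w) (φ (a v)) := by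
              rw [← ha, ← hφ, hy, ← hiso, hsymm, hiso]
          _ = - BΛ w (ι (φ (a v) - a v)) := by rw [z_spec, map_sub, map_sub]; ring
          _ = - (d v * BΛ w (ι (z v))) := by rw [hz, map_zsmul, map_zsmul, smul_eq_mul]
      have h₃ : BΛ v (ι y) = - BΛ w (ι (z v)) :=
        mul_left_cancel₀ (hd v) (by rw [h₂]; ring)
      rw [h₁, h₃]; ring
    simp only [F_apply, map_add, LinearMap.add_apply, hiso]
    rw [hsymm (ι (z v)) w]
    linarith
  have F_ι (x : L) : F (ι x) = ι (φ x) := by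
    have : z (ι x) = φ x - x := z_unique _ _ fun y => by
      rw [map_sub, LinearMap.sub_apply, hφ, hiso, hiso]
    rw [F_apply, this, map_sub, add_sub_cancel]
  have F_T (t : Λ) (ht : t ∈ T) : F t = t := by
    have : z t = 0 := z_unique _ _ fun y => by
      rw [(hT t).mp ht, (hT t).mp ht, map_zero, LinearMap.zero_apply, sub_zero]
    rw [F_apply, this, map_zero, add_zero]
  have F_inj : Function.Injective F := by
    refine (injective_iff_map_eq_zero F).mpr fun v hv => hnd v fun w => ?_
    rw [← F_isometry, hv, map_zero, LinearMap.zero_apply]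
  have smul_mem_range (v : Λ) : ∃ u, F u = d v • v := by
    have ht : d v • v - ι (a v) ∈ T := (hT _).mpr fun y => by
      rw [map_sub, LinearMap.sub_apply, bilinForm_zsmul_left, hiso, ha, sub_self]
    refine ⟨d v • v - ι (a v) + ι (φ.symm (a v)), ?_⟩
    rw [map_add, F_T _ ht, F_ι, φ.apply_symm_apply, sub_add_cancel]
  have F_surj : Function.Surjective F := by
    intro w
    obtain ⟨u, hu⟩ := hunimod.2 ((BΛ w).comp F)
    have hu' (x : Λ) : BΛ u x = BΛ w (F x) := LinearMap.congr_fun hu x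
    refine ⟨u, sub_eq_zero.mp (hnd _ fun v => mul_left_cancel₀ (hd v) ?_)⟩
    obtain ⟨x, hx⟩ := smul_mem_range v
    rw [← smul_eq_mul, ← map_zsmul, ← hx, map_sub, LinearMap.sub_apply, F_isometry, hu',
      sub_self, mul_zero]
  exact ⟨LinearEquiv.ofBijective F ⟨F_inj, F_surj⟩, F_isometry, F_ι, F_T⟩
end

section
/- Let Λ be a unimodular lattice, let L ⊆ Λ be a primitive sublattice on which the bilinear form is nondegenerate, and suppose the orthogonal complement T = L^⊥ has a ℤ-basis c, d with (c,c) = (d,d) = 2 and (c,d) = −1 (so T is isometric to the root lattice A2). If φ is an isometry of L that acts as −id on the discriminant group A_L, then there exists an isometry Φ of Λ such that Φ restricted to L equals φ, Φ(c) = d, and Φ(d) = c. -/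
open TensorProduct
open Module

/-- A linear map whose range lies in that of an injective one factors through it. -/
theorem LinearMap.exists_comp_eq_of_injective {R M N P : Type*} [Ring R]
    [AddCommGroup M] [Module R M] [AddCommGroup N] [Module R N] [AddCommGroup P] [Module R P]
    (i : N →ₗ[R] P) (hi : Function.Injective i) (f : M →ₗ[R] P)
    (hf : ∀ x, f x ∈ LinearMap.range i) : ∃ g : M →ₗ[R] N, ∀ x, i (g x) = f x := by
  refine ⟨(LinearEquiv.ofInjective i hi).symm.toLinearMap ∘ₗ f.codRestrict _ hf, fun x => ?_⟩
  have h := LinearEquiv.apply_symm_apply (LinearEquiv.ofInjective i hi) (f.codRestrict _ hf x)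
  exact congrArg Subtype.val h

/-- Over a domain, a form with trivial kernel on a finite free module represents every functional
up to a nonzero multiple. -/
theorem LinearMap.BilinForm.exists_smul_eq_of_nondegenerate {R L : Type*} [CommRing R] [IsDomain R]
    [AddCommGroup L] [Module R L] [Module.Free R L] [Module.Finite R L]
    (B : LinearMap.BilinForm R L) (hB : ∀ x : L, (∀ y : L, B x y = 0) → x = 0)
    (g : Dual R L) : ∃ (n : R) (l : L), n ≠ 0 ∧ n • g = B l := by
  have hdual : finrank R (Dual R L) = finrank R L := by
    rw [finrank_linearMap_self]
  let F : L × R →ₗ[R] Dual R L := B.coprod (LinearMap.toSpanSingleton R _ (-g))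
  have hF : ¬ Function.Injective F := fun h => by
    have := LinearMap.finrank_le_finrank_of_injective h
    rw [hdual, finrank_prod, finrank_self] at this
    omega
  rw [← LinearMap.ker_eq_bot, Submodule.eq_bot_iff] at hF
  push Not at hF
  obtain ⟨⟨l, n⟩, hker, hne⟩ := hF
  have h : B l = n • g := by
    simpa [F, ← sub_eq_add_neg, sub_eq_zero] using hker
  refine ⟨n, l, ?_, h.symm⟩
  rintro rfl
  rw [zero_smul] at h
  exact hne (by simp [hB l (fun y => by simp [h])])

/-- If `φ` acts as `-id` on the discriminant group and `l / n` lies in the dual lattice, then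
`φ l + l` is divisible by `n` in `L`. -/
theorem exists_add_eq_smul_of_neg_id_on_discriminant {R L : Type*} (K : Type*) [CommRing R]
    [Field K] [Algebra R K] [FaithfulSMul R K] [AddCommGroup L] [Module R L] [Module.Free R L]
    (B : LinearMap.BilinForm R L) (φ : L →ₗ[R] L)
    (hdisc : ∀ x : K ⊗[R] L,
      (∀ y : L, ∃ n : R,
        LinearMap.BilinForm.baseChange K B x ((1 : K) ⊗ₜ[R] y) = algebraMap R K n) →
      ∃ z : L, LinearMap.baseChange K φ x + x = (1 : K) ⊗ₜ[R] z)
    {n : R} (hn : n ≠ 0) (l : L) (hl : ∀ y, n ∣ B l y) : ∃ z : L, φ l + l = n • z := by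
  have hK := FaithfulSMul.algebraMap_injective R K
  have hn' : algebraMap R K n ≠ 0 := (map_ne_zero_iff _ hK).2 hn
  obtain ⟨z, hz⟩ := hdisc ((algebraMap R K n)⁻¹ ⊗ₜ[R] l) (fun y => by
    obtain ⟨k, hk⟩ := hl y
    refine ⟨k, ?_⟩
    rw [LinearMap.BilinForm.baseChange_tmul, hk, mul_one, mul_smul, Algebra.smul_def,
      Algebra.smul_def]
    field_simp)
  refine ⟨z, ?_⟩
  rw [LinearMap.baseChange_tmul, ← TensorProduct.tmul_add] at hz
  have hz' := congrArg (fun t => algebraMap R K n • t) hz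
  simp only [TensorProduct.smul_tmul', smul_eq_mul, mul_inv_cancel₀ hn', mul_one] at hz'
  let b := Module.Free.chooseBasis R L
  apply b.repr.injective
  ext i
  have := congrArg (fun t => (b.baseChange K).repr t i) hz'
  simp only [Basis.baseChange_repr_tmul, Algebra.smul_def, mul_one] at this
  apply hK
  rw [map_smul, Finsupp.smul_apply, smul_eq_mul, map_mul, this, mul_comm]

section A2

variable {R Λ L : Type*} [CommRing R] [AddCommGroup Λ] [Module R Λ] [AddCommGroup L] [Module R L]

/-- The element `3 v`, where `v` is the orthogonal projection of `x` to the span of vectors `c`, `d`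
with Gram matrix of type `A₂`. -/
def a2Proj (B : LinearMap.BilinForm R Λ) (c d : Λ) : Λ →ₗ[R] Λ :=
  ((2 : R) • B c + B d).smulRight c + (B c + (2 : R) • B d).smulRight d

theorem a2Proj_apply (B : LinearMap.BilinForm R Λ) (c d x : Λ) :
    a2Proj B c d x = (2 * B c x + B d x) • c + (B c x + 2 * B d x) • d := by
  simp [a2Proj]

/-- Three times the projection of `x` to the complement of the span of `c` and `d` lies in `L`. -/
theorem three_smul_sub_a2Proj_mem_range [IsDomain R] [CharZero R]
    [Module.Free R L] [Module.Finite R L]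
    {BΛ : LinearMap.BilinForm R Λ} {BL : LinearMap.BilinForm R L}
    (hsymm : ∀ x y, BΛ x y = BΛ y x) (ι : L →ₗ[R] Λ)
    (hiso : ∀ x y, BΛ (ι x) (ι y) = BL x y)
    (hprim : ∀ (x : Λ) (n : R), n ≠ 0 → n • x ∈ LinearMap.range ι → x ∈ LinearMap.range ι)
    (hLnd : ∀ x : L, (∀ y : L, BL x y = 0) → x = 0) {c d : Λ}
    (hc : ∀ y : L, BΛ c (ι y) = 0) (hd : ∀ y : L, BΛ d (ι y) = 0)
    (hcc : BΛ c c = 2) (hdd : BΛ d d = 2) (hcd : BΛ c d = -1)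
    (hspan : ∀ t : Λ, (∀ y : L, BΛ t (ι y) = 0) → ∃ p : R × R, t = p.1 • c + p.2 • d)
    (x : Λ) : (3 : R) • x - a2Proj BΛ c d x ∈ LinearMap.range ι := by
  have hdc : BΛ d c = -1 := by rw [hsymm, hcd]
  set u := (3 : R) • x - a2Proj BΛ c d x with hu
  have huc : BΛ c u = 0 := by
    simp only [hu, a2Proj_apply, map_sub, map_add, map_smul, smul_eq_mul, hcc, hcd]; ring
  have hud : BΛ d u = 0 := by
    simp only [hu, a2Proj_apply, map_sub, map_add, map_smul, smul_eq_mul, hdd, hdc]; ring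
  obtain ⟨n, l, hn, hl⟩ := BL.exists_smul_eq_of_nondegenerate hLnd (BΛ u ∘ₗ ι)
  obtain ⟨⟨p, q⟩, hpq⟩ := hspan (n • u - ι l) (fun y => by
    have := congrArg (fun f => f y) hl
    simp only [LinearMap.smul_apply, LinearMap.comp_apply] at this
    rw [map_sub, map_smul, LinearMap.sub_apply, LinearMap.smul_apply, this, hiso, sub_self])
  have h1 := congrArg (BΛ c) hpq
  have h2 := congrArg (BΛ d) hpq
  simp only [map_sub, map_add, map_smul, smul_eq_mul, hcc, hcd, hdd, hdc, huc, hud, hc, hd]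
    at h1 h2
  have hp : (3 : R) * p = 0 := by linear_combination -2 * h1 - h2
  have hq : (3 : R) * q = 0 := by linear_combination -h1 - 2 * h2
  simp only [mul_eq_zero, OfNat.ofNat_ne_zero, false_or] at hp hq
  subst hp hq
  refine hprim u n hn ⟨l, ?_⟩
  rw [zero_smul, zero_smul, add_zero, sub_eq_zero] at hpq
  exact hpq.symm

/-- If `3 Λ ⊆ L + ⟨c, d⟩` and `φ + id` is divisible by `3` on the `L`-components, then `φ` and the
swap of `c` and `d` glue to an endomorphism of `Λ`. -/
theorem exists_extension_swap [IsDomain R] [CharZero R] [Module.IsTorsionFree R Λ]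
    (B : LinearMap.BilinForm R Λ) (ι : L →ₗ[R] Λ)
    (c d : Λ) (P : Λ →ₗ[R] L) (hP : ∀ x, ι (P x) = (3 : R) • x - a2Proj B c d x)
    (φ : L →ₗ[R] L) (hφ : ∀ x, ∃ z, φ (P x) + P x = (3 : R) • z) :
    ∃ F : Λ →ₗ[R] Λ, ∀ x, (3 : R) • F x =
      ι (φ (P x)) + ((2 * B c x + B d x) • d + (B c x + 2 * B d x) • c) := by
  obtain ⟨F, hF⟩ := LinearMap.exists_comp_eq_of_injective
    (LinearMap.lsmul R Λ 3) (smul_right_injective Λ (by norm_num : (3 : R) ≠ 0))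
    (ι ∘ₗ φ ∘ₗ P +
      (((2 : R) • B c + B d).smulRight d + (B c + (2 : R) • B d).smulRight c))
    (fun x => by
      obtain ⟨z, hz⟩ := hφ x
      have h := congrArg ι hz
      rw [map_add, hP, map_smul, a2Proj_apply] at h
      refine ⟨ι z - x + (B c x + B d x) • (c + d), ?_⟩
      simp only [LinearMap.lsmul_apply, LinearMap.add_apply, LinearMap.comp_apply,
        LinearMap.smulRight_apply, LinearMap.smul_apply, smul_eq_mul]
      rw [eq_sub_of_add_eq h]
      module)
  exact ⟨F, fun x => by simpa using hF x⟩

/-- An isometry `φ` of a primitive nondegenerate `L` whose complement is of type `A₂` extends by the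
swap of `c` and `d`, provided `φ + id` is divisible by `3` on the vectors of `L` that pair into
`3 R`. -/
theorem exists_isometry_extension_swap [IsDomain R] [CharZero R] [Module.IsTorsionFree R Λ]
    [Module.Free R L] [Module.Finite R L]
    {BΛ : LinearMap.BilinForm R Λ} {BL : LinearMap.BilinForm R L}
    (hsymm : ∀ x y, BΛ x y = BΛ y x) (ι : L →ₗ[R] Λ) (hinj : Function.Injective ι)
    (hiso : ∀ x y, BΛ (ι x) (ι y) = BL x y)
    (hprim : ∀ (x : Λ) (n : R), n ≠ 0 → n • x ∈ LinearMap.range ι → x ∈ LinearMap.range ι)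
    (hLnd : ∀ x : L, (∀ y : L, BL x y = 0) → x = 0) {c d : Λ}
    (hc : ∀ y : L, BΛ c (ι y) = 0) (hd : ∀ y : L, BΛ d (ι y) = 0)
    (hcc : BΛ c c = 2) (hdd : BΛ d d = 2) (hcd : BΛ c d = -1)
    (hspan : ∀ t : Λ, (∀ y : L, BΛ t (ι y) = 0) → ∃ p : R × R, t = p.1 • c + p.2 • d)
    (φ : L ≃ₗ[R] L) (hφ : ∀ x y, BL (φ x) (φ y) = BL x y)
    (hdiv : ∀ l, (∀ y, 3 ∣ BL l y) → ∃ z, φ l + l = (3 : R) • z) :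
    ∃ Φ : Λ ≃ₗ[R] Λ, (∀ x y, BΛ (Φ x) (Φ y) = BΛ x y) ∧
      (∀ x : L, Φ (ι x) = ι (φ x)) ∧ Φ c = d ∧ Φ d = c := by
  have hdc : BΛ d c = -1 := by rw [hsymm, hcd]
  have h3 : (3 : R) ≠ 0 := by norm_num
  have hcancel := smul_right_injective Λ h3
  have hc' : ∀ y, BΛ (ι y) c = 0 := fun y => by rw [hsymm, hc]
  have hd' : ∀ y, BΛ (ι y) d = 0 := fun y => by rw [hsymm, hd]
  obtain ⟨P, hP⟩ := LinearMap.exists_comp_eq_of_injective ι hinj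
    ((3 : R) • LinearMap.id - a2Proj BΛ c d) (fun x =>
      three_smul_sub_a2Proj_mem_range hsymm ι hiso hprim hLnd hc hd hcc hdd hcd hspan x)
  replace hP : ∀ x, ι (P x) = (3 : R) • x - a2Proj BΛ c d x := fun x => by simpa using hP x
  have hdec : ∀ x, (3 : R) • x =
      ι (P x) + ((2 * BΛ c x + BΛ d x) • c + (BΛ c x + 2 * BΛ d x) • d) := fun x => by
    rw [hP, a2Proj_apply, sub_add_cancel]
  have hPdiv : ∀ x y, 3 ∣ BL (P x) y := fun x y => by
    refine ⟨BΛ x (ι y), ?_⟩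
    rw [← hiso, hP, a2Proj_apply]
    simp [hc, hd]
  have hPι : ∀ y, P (ι y) = (3 : R) • y := fun y => hinj (by
    rw [hP, a2Proj_apply, hc, hd, map_smul]
    simp)
  have hPc : P c = 0 := hinj (by
    rw [hP, a2Proj_apply, hcc, hdc, map_zero]
    module)
  have hPd : P d = 0 := hinj (by
    rw [hP, a2Proj_apply, hcd, hdd, map_zero]
    module)
  obtain ⟨F, hF⟩ := exists_extension_swap BΛ ι c d P hP φ.toLinearMap
    (fun x => hdiv _ (hPdiv x))
  obtain ⟨G, hG⟩ := exists_extension_swap BΛ ι c d P hP φ.symm.toLinearMap (fun x => by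
    obtain ⟨z, hz⟩ := hdiv _ (hPdiv x)
    refine ⟨φ.symm z, φ.injective ?_⟩
    simp [← hz, add_comm])
  have comp_eq : ∀ (ψ χ : L ≃ₗ[R] L) (_ : ∀ l, ψ (χ l) = l) (F G : Λ →ₗ[R] Λ)
      (_ : ∀ x, (3 : R) • F x =
        ι (ψ (P x)) + ((2 * BΛ c x + BΛ d x) • d + (BΛ c x + 2 * BΛ d x) • c))
      (_ : ∀ x, (3 : R) • G x =
        ι (χ (P x)) + ((2 * BΛ c x + BΛ d x) • d + (BΛ c x + 2 * BΛ d x) • c)) (x : Λ),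
      F (G x) = x := by
    intro ψ χ hψχ F G hF hG x
    have hFι : ∀ l, F (ι l) = ι (ψ l) := fun l => hcancel (by
      simp only [hF, hPι, hc, hd, map_smul]
      simp)
    have hFc : F c = d := hcancel (by
      simp only [hF, hPc, hcc, hdc, map_zero]
      module)
    have hFd : F d = c := hcancel (by
      simp only [hF, hPd, hcd, hdd, map_zero]
      module)
    refine hcancel ?_
    simp only
    rw [← map_smul F, hG]
    simp only [map_add, map_smul, hFι, hFc, hFd, hψχ]
    rw [hdec x]
  refine ⟨LinearEquiv.ofLinearMap F G
    (LinearMap.ext (comp_eq φ φ.symm φ.apply_symm_apply F G hF hG))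
    (LinearMap.ext (comp_eq φ.symm φ φ.symm_apply_apply G F hG hF)), ?_, ?_, ?_, ?_⟩
  · intro x y
    have h9 : BΛ ((3 : R) • F x) ((3 : R) • F y) = BΛ ((3 : R) • x) ((3 : R) • y) := by
      rw [hF, hF, hdec x, hdec y]
      simp only [map_add, map_smul, LinearMap.add_apply, LinearMap.smul_apply, smul_eq_mul,
        LinearEquiv.coe_coe, hiso, hφ, hc, hd, hc', hd', hcc, hdd, hcd, hdc]
    simp only [map_smul, LinearMap.smul_apply, smul_eq_mul] at h9
    exact mul_left_cancel₀ h3 (mul_left_cancel₀ h3 h9)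
  · intro l
    refine hcancel ?_
    simp only [LinearEquiv.coe_ofLinearMap, hF, hPι, hc, hd, map_smul]
    simp
  · refine hcancel ?_
    simp only [LinearEquiv.coe_ofLinearMap, hF, hPc, hcc, hdc, map_zero]
    module
  · refine hcancel ?_
    simp only [LinearEquiv.coe_ofLinearMap, hF, hPd, hcd, hdd, map_zero]
    module

end A2

/-- Let `Λ` be a unimodular lattice, `L ⊆ Λ` a primitive sublattice on which
the bilinear form is nondegenerate, and suppose `T = L^⊥` has a ℤ-basis `c, d` with
`(c,c) = (d,d) = 2` and `(c,d) = -1` (so `T ≅ A₂`). If `φ` is an isometry of `L` acting as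
`-id` on the discriminant group `A_L`, then `φ` extends to an isometry `Φ` of `Λ` with
`Φ(c) = d` and `Φ(d) = c`. -/
theorem stmt_1
    (Λ L : Type) [AddCommGroup Λ] [Module ℤ Λ] [Module.Free ℤ Λ] [Module.Finite ℤ Λ]
    [AddCommGroup L] [Module ℤ L] [Module.Free ℤ L] [Module.Finite ℤ L]
    (BΛ : LinearMap.BilinForm ℤ Λ) (BL : LinearMap.BilinForm ℤ L)
    -- the form on Λ is symmetric and nondegenerate
    (hsymm : ∀ x y, BΛ x y = BΛ y x)
    (hnd : ∀ x, (∀ y, BΛ x y = 0) → x = 0)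
    -- Λ is unimodular
    (hunimod : Function.Bijective (fun x : Λ => BΛ x))
    -- ι : L → Λ is an isometric embedding
    (ι : L →ₗ[ℤ] Λ)
    (hinj : Function.Injective ι)
    (hiso : ∀ x y, BΛ (ι x) (ι y) = BL x y)
    -- L is primitive in Λ
    (hprim : ∀ (x : Λ) (n : ℤ), n ≠ 0 → n • x ∈ LinearMap.range ι →
      x ∈ LinearMap.range ι)
    -- the bilinear form is nondegenerate on L
    (hLnd : ∀ x : L, (∀ y : L, BL x y = 0) → x = 0)
    -- c, d form a ℤ-basis of T = L^⊥ with Gram matrix of A₂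
    (c d : Λ)
    (hc : ∀ y : L, BΛ c (ι y) = 0)
    (hd : ∀ y : L, BΛ d (ι y) = 0)
    (hcc : BΛ c c = 2) (hdd : BΛ d d = 2) (hcd : BΛ c d = -1)
    (hbasis : ∀ t : Λ, (∀ y : L, BΛ t (ι y) = 0) →
      ∃! p : ℤ × ℤ, t = p.1 • c + p.2 • d)
    -- φ is an isometry of L
    (φ : L ≃ₗ[ℤ] L)
    (hφ : ∀ x y, BL (φ x) (φ y) = BL x y)
    -- φ acts as -id on the discriminant group A_L = L^∨/L
    (hdisc : ∀ x : ℚ ⊗[ℤ] L,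
      (∀ y : L, ∃ n : ℤ, LinearMap.BilinForm.baseChange ℚ BL x ((1 : ℚ) ⊗ₜ[ℤ] y) = (n : ℚ)) →
      ∃ z : L, LinearMap.baseChange ℚ (φ : L →ₗ[ℤ] L) x + x = (1 : ℚ) ⊗ₜ[ℤ] z) :
    -- conclusion: φ extends to an isometry Φ of Λ swapping c and d
    ∃ Φ : Λ ≃ₗ[ℤ] Λ, (∀ x y, BΛ (Φ x) (Φ y) = BΛ x y) ∧
      (∀ x : L, Φ (ι x) = ι (φ x)) ∧ Φ c = d ∧ Φ d = c := by
  exact exists_isometry_extension_swap hsymm ι hinj hiso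
    (fun x n hn h => hprim x n hn (by rwa [← int_smul_eq_zsmul ‹Module ℤ Λ›])) hLnd
    hc hd hcc hdd hcd
    (fun t ht => by
      obtain ⟨p, hp⟩ := (hbasis t ht).exists
      exact ⟨p, hp.trans (congrArg₂ (· + ·) (int_smul_eq_zsmul _ _ _).symm
        (int_smul_eq_zsmul _ _ _).symm)⟩) φ hφ
    (exists_add_eq_smul_of_neg_id_on_discriminant ℚ BL φ.toLinearMap hdisc (n := 3) (by decide))
end

section
/- Let Λ be a unimodular lattice, L ⊆ Λ a primitive sublattice on which the form is nondegenerate, T = L^⊥, and let φ be an isometry of L acting trivially on the discriminant group A_L. Let Φ be an isometry of Λ with Φ restricted to L equal to φ and Φ restricted to T equal to the identity. Then the coinvariant lattice of Φ in Λ equals the coinvariant lattice of φ in L, i.e. Λ_Φ = L_φ, and moreover L ∩ Λ^Φ = L^φ. -/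
open TensorProduct

/-- A nondegenerate bilinear form on a lattice represents a nonzero multiple of every functional. -/
lemma exists_smul_eq_of_bilinForm_injective {L : Type*} [AddCommGroup L] [Module ℤ L]
    [Module.Free ℤ L] [Module.Finite ℤ L] (B : LinearMap.BilinForm ℤ L)
    (hB : ∀ x : L, (∀ y : L, B x y = 0) → x = 0) (f : L →ₗ[ℤ] ℤ) :
    ∃ (n : ℤ) (l : L), n ≠ 0 ∧ B l = n • f := by
  have hinj : Function.Injective B := (injective_iff_map_eq_zero B).2 fun x hx =>
    hB x fun y => by simp [hx]
  have hrank : Module.finrank ℤ (LinearMap.range B) = Module.finrank ℤ (L →ₗ[ℤ] ℤ) := by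
    rw [LinearMap.finrank_range_of_inj hinj, Module.finrank_linearMap_self]
  have : Finite ((L →ₗ[ℤ] ℤ) ⧸ LinearMap.range B) :=
    Submodule.finiteQuotientOfFreeOfRankEq _ hrank
  obtain ⟨l, hl⟩ : Nat.card ((L →ₗ[ℤ] ℤ) ⧸ LinearMap.range B) • f ∈ LinearMap.range B := by
    rw [← Submodule.Quotient.mk_eq_zero, Submodule.Quotient.mk_smul]
    exact card_nsmul_eq_zero'
  exact ⟨Nat.card ((L →ₗ[ℤ] ℤ) ⧸ LinearMap.range B), l,
    Nat.cast_ne_zero.2 Nat.card_pos.ne', by rw [hl, natCast_zsmul]⟩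

/-- Let `Λ` be a unimodular lattice, `L ⊆ Λ` a primitive sublattice on which
the form is nondegenerate, `T = L^⊥`, and `φ` an isometry of `L` acting trivially on the
discriminant group `A_L`. Let `Φ` be an isometry of `Λ` restricting to `φ` on `L` and to the
identity on `T`. Then the coinvariant lattice of `Φ` in `Λ` equals the coinvariant lattice of
`φ` in `L` (i.e. `Λ_Φ = L_φ`), and `L ∩ Λ^Φ = L^φ`. -/
theorem stmt_2
    (Λ L : Type) [AddCommGroup Λ] [Module ℤ Λ] [Module.Free ℤ Λ] [Module.Finite ℤ Λ]
    [AddCommGroup L] [Module ℤ L] [Module.Free ℤ L] [Module.Finite ℤ L]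
    (BΛ : LinearMap.BilinForm ℤ Λ) (BL : LinearMap.BilinForm ℤ L)
    -- the form on Λ is symmetric and nondegenerate
    (hsymm : ∀ x y, BΛ x y = BΛ y x)
    (hnd : ∀ x, (∀ y, BΛ x y = 0) → x = 0)
    -- Λ is unimodular
    (hunimod : Function.Bijective (fun x : Λ => BΛ x))
    -- ι : L → Λ is an isometric embedding
    (ι : L →ₗ[ℤ] Λ)
    (hinj : Function.Injective ι)
    (hiso : ∀ x y, BΛ (ι x) (ι y) = BL x y)
    -- L is primitive in Λ
    (hprim : ∀ (x : Λ) (n : ℤ), n ≠ 0 → n • x ∈ LinearMap.range ι →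
      x ∈ LinearMap.range ι)
    -- the bilinear form is nondegenerate on L
    (hLnd : ∀ x : L, (∀ y : L, BL x y = 0) → x = 0)
    -- T = L^⊥
    (T : Submodule ℤ Λ)
    (hT : ∀ x, x ∈ T ↔ ∀ y : L, BΛ x (ι y) = 0)
    -- φ is an isometry of L acting trivially on the discriminant group A_L
    (φ : L ≃ₗ[ℤ] L)
    (hφ : ∀ x y, BL (φ x) (φ y) = BL x y)
    (hdisc : ∀ x : ℚ ⊗[ℤ] L,
      (∀ y : L, ∃ n : ℤ, LinearMap.BilinForm.baseChange ℚ BL x ((1 : ℚ) ⊗ₜ[ℤ] y) = (n : ℚ)) →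
      ∃ z : L, LinearMap.baseChange ℚ (φ : L →ₗ[ℤ] L) x - x = (1 : ℚ) ⊗ₜ[ℤ] z)
    -- Φ is an isometry of Λ restricting to φ on L and to the identity on T
    (Φ : Λ ≃ₗ[ℤ] Λ)
    (hΦ : ∀ x y, BΛ (Φ x) (Φ y) = BΛ x y)
    (hrest : ∀ x : L, Φ (ι x) = ι (φ x))
    (hfix : ∀ t ∈ T, Φ t = t) :
    -- Λ_Φ = L_φ (inside Λ, identifying L with its image under ι)
    {x : Λ | ∀ y : Λ, Φ y = y → BΛ x y = 0}
      = (⇑ι) '' {x : L | ∀ y : L, φ y = y → BL x y = 0} ∧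
    -- L ∩ Λ^Φ = L^φ
    Set.range ι ∩ {x : Λ | Φ x = x} = (⇑ι) '' {x : L | φ x = x} := by
  have hdecomp : ∀ y : Λ, ∃ (n : ℤ) (l : L), n ≠ 0 ∧ n • y - ι l ∈ T := fun y => by
    obtain ⟨n, l, hn, hl⟩ := exists_smul_eq_of_bilinForm_injective BL hLnd ((BΛ y).comp ι)
    refine ⟨n, l, hn, (hT _).2 fun z => ?_⟩
    have hz := LinearMap.congr_fun hl z
    simp only [LinearMap.smul_apply, LinearMap.comp_apply] at hz
    simp [hiso, hz]
  have horth : ∀ t ∈ T, ∀ l, BΛ (ι l) t = 0 := fun t ht l => by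
    rw [hsymm]
    exact (hT t).1 ht l
  refine ⟨Set.ext fun x => ⟨fun hx => ?_, ?_⟩, Set.ext fun x => ⟨?_, ?_⟩⟩
  · obtain ⟨n, l, hn, hl⟩ := hdecomp x
    have hzero : n • x - ι l = 0 := hnd _ fun y => by
      obtain ⟨m, k, hm, hk⟩ := hdecomp y
      have h₁ : BΛ (n • x - ι l) (m • y - ι k) = 0 := by
        rw [map_sub BΛ, map_zsmul BΛ, LinearMap.sub_apply, LinearMap.smul_apply,
          hx _ (hfix _ hk), horth _ hk, smul_zero, sub_zero]
      rw [map_sub, map_zsmul, (hT _).1 hl k, sub_zero] at h₁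
      exact (smul_eq_zero.1 h₁).resolve_left hm
    obtain ⟨k, rfl⟩ := hprim x n hn ⟨l, (sub_eq_zero.1 hzero).symm⟩
    refine ⟨k, fun y hy => ?_, rfl⟩
    rw [← hiso]
    exact hx _ (by rw [hrest, hy])
  · rintro ⟨l, hl, rfl⟩ y hy
    obtain ⟨n, k, hn, hk⟩ := hdecomp y
    have hfixed := hfix _ hk
    rw [map_sub, map_zsmul, hy, hrest, sub_right_inj] at hfixed
    have h₁ := horth _ hk l
    rw [map_sub, map_zsmul, hiso, hl k (hinj hfixed), sub_zero] at h₁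
    exact (smul_eq_zero.1 h₁).resolve_left hn
  · rintro ⟨⟨l, rfl⟩, hl⟩
    exact ⟨l, hinj ((hrest l).symm.trans hl), rfl⟩
  · rintro ⟨l, hl, rfl⟩
    exact ⟨⟨l, rfl⟩, (hrest l).trans (congrArg ι hl)⟩
end

section
/- Let Λ be a unimodular lattice, L ⊆ Λ a primitive sublattice on which the form is nondegenerate, and suppose T = L^⊥ has a ℤ-basis c, d with (c,c) = (d,d) = 2 and (c,d) = −1. Let φ be an isometry of L and let Φ be an isometry of Λ with Φ restricted to L equal to φ, Φ(c) = d and Φ(d) = c. Then the invariant and coinvariant lattices satisfy L_φ = {x ∈ Λ_Φ : (x, c−d) = 0} and L^φ = {x ∈ Λ^Φ : (x, c+d) = 0}. -/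
/-- For a bilinear form with trivial left kernel on a finite free module over a domain, some nonzero
multiple of every functional is represented by a vector. -/
theorem exists_smul_eq_of_left_nondegenerate {R L : Type*} [CommRing R] [IsDomain R]
    [AddCommGroup L] [Module R L] [Module.Free R L] [Module.Finite R L]
    (B : LinearMap.BilinForm R L)
    (hB : ∀ x : L, (∀ y : L, B x y = 0) → x = 0) (f : L →ₗ[R] R) :
    ∃ (n : R) (l : L), n ≠ 0 ∧ B l = n • f := by
  let g : L × R →ₗ[R] Module.Dual R L := B.coprod (LinearMap.toSpanSingleton R _ f)
  have hg : ¬ Function.Injective g := fun h => by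
    have h1 := LinearMap.finrank_le_finrank_of_injective h
    have h2 : Module.finrank R (Module.Dual R L) = Module.finrank R L := by
      classical exact (Module.Free.chooseBasis R L).toDualEquiv.finrank_eq.symm
    rw [Module.finrank_prod, Module.finrank_self, h2] at h1
    omega
  rw [injective_iff_map_eq_zero] at hg
  push Not at hg
  obtain ⟨⟨l, n⟩, h0, hne⟩ := hg
  have h1 : B l + n • f = 0 := by simpa [g] using h0
  refine ⟨-n, l, ?_, ?_⟩
  · intro hn
    obtain rfl : n = 0 := neg_eq_zero.mp hn
    have hl : l = 0 := hB l fun y => by simpa using LinearMap.congr_fun h1 y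
    exact hne (by simp [hl])
  · ext y
    have h2 : B l y + n * f y = 0 := by simpa using LinearMap.congr_fun h1 y
    simpa using eq_neg_of_add_eq_zero_left h2

/-- Some nonzero multiple of every vector of the ambient lattice splits as a vector of a
nondegenerate sublattice plus a vector orthogonal to it. -/
theorem exists_smul_eq_add_orthogonal {M L : Type*} [AddCommGroup M] [Module ℤ M]
    [AddCommGroup L] [Module ℤ L] [Module.Free ℤ L] [Module.Finite ℤ L]
    (B : LinearMap.BilinForm ℤ M) (C : LinearMap.BilinForm ℤ L) (ι : L →ₗ[ℤ] M)
    (hiso : ∀ x y, B (ι x) (ι y) = C x y)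
    (hC : ∀ x : L, (∀ y : L, C x y = 0) → x = 0) (x : M) :
    ∃ (n : ℤ) (l : L) (t : M), n ≠ 0 ∧ n • x = ι l + t ∧ ∀ y : L, B t (ι y) = 0 := by
  obtain ⟨n, l, hn, hl⟩ := exists_smul_eq_of_left_nondegenerate C hC (B x ∘ₗ ι)
  refine ⟨n, l, n • x - ι l, hn, by abel, fun y => ?_⟩
  have := LinearMap.congr_fun hl y
  simp only [LinearMap.smul_apply, LinearMap.comp_apply] at this
  simp [hiso, this]


/-- Let `Λ` be a unimodular lattice, `L ⊆ Λ` a primitive sublattice on which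
the form is nondegenerate, and suppose `T = L^⊥` has a ℤ-basis `c, d` with
`(c,c) = (d,d) = 2`, `(c,d) = -1`. Let `φ` be an isometry of `L` and `Φ` an isometry of `Λ`
restricting to `φ` on `L` with `Φ(c) = d`, `Φ(d) = c`. Then
`L_φ = {x ∈ Λ_Φ : (x, c-d) = 0}` and `L^φ = {x ∈ Λ^Φ : (x, c+d) = 0}`
(inside `Λ`, identifying `L` with its image under `ι`). -/
theorem stmt_3
    (Λ L : Type) [AddCommGroup Λ] [Module ℤ Λ] [Module.Free ℤ Λ] [Module.Finite ℤ Λ]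
    [AddCommGroup L] [Module ℤ L] [Module.Free ℤ L] [Module.Finite ℤ L]
    (BΛ : LinearMap.BilinForm ℤ Λ) (BL : LinearMap.BilinForm ℤ L)
    -- the form on Λ is symmetric and nondegenerate
    (hsymm : ∀ x y, BΛ x y = BΛ y x)
    (hnd : ∀ x, (∀ y, BΛ x y = 0) → x = 0)
    -- Λ is unimodular
    (hunimod : Function.Bijective (fun x : Λ => BΛ x))
    -- ι : L → Λ is an isometric embedding
    (ι : L →ₗ[ℤ] Λ)
    (hinj : Function.Injective ι)
    (hiso : ∀ x y, BΛ (ι x) (ι y) = BL x y)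
    -- L is primitive in Λ
    (hprim : ∀ (x : Λ) (n : ℤ), n ≠ 0 → n • x ∈ LinearMap.range ι →
      x ∈ LinearMap.range ι)
    -- the bilinear form is nondegenerate on L
    (hLnd : ∀ x : L, (∀ y : L, BL x y = 0) → x = 0)
    -- c, d form a ℤ-basis of T = L^⊥ with Gram matrix of A₂
    (c d : Λ)
    (hc : ∀ y : L, BΛ c (ι y) = 0)
    (hd : ∀ y : L, BΛ d (ι y) = 0)
    (hcc : BΛ c c = 2) (hdd : BΛ d d = 2) (hcd : BΛ c d = -1)
    (hbasis : ∀ t : Λ, (∀ y : L, BΛ t (ι y) = 0) →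
      ∃! p : ℤ × ℤ, t = p.1 • c + p.2 • d)
    -- φ is an isometry of L
    (φ : L ≃ₗ[ℤ] L)
    (hφ : ∀ x y, BL (φ x) (φ y) = BL x y)
    -- Φ is an isometry of Λ restricting to φ on L, swapping c and d
    (Φ : Λ ≃ₗ[ℤ] Λ)
    (hΦ : ∀ x y, BΛ (Φ x) (Φ y) = BΛ x y)
    (hrest : ∀ x : L, Φ (ι x) = ι (φ x))
    (hΦc : Φ c = d) (hΦd : Φ d = c) :
    -- L_φ = {x ∈ Λ_Φ : (x, c-d) = 0}
    (⇑ι) '' {x : L | ∀ y : L, φ y = y → BL x y = 0}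
      = {x : Λ | (∀ y : Λ, Φ y = y → BΛ x y = 0) ∧ BΛ x (c - d) = 0} ∧
    -- L^φ = {x ∈ Λ^Φ : (x, c+d) = 0}
    (⇑ι) '' {x : L | φ x = x}
      = {x : Λ | Φ x = x ∧ BΛ x (c + d) = 0} := by
  have hdc : BΛ d c = -1 := by rw [hsymm, hcd]
  have mem_range {x : Λ} (hxc : BΛ x c = 0) (hxd : BΛ x d = 0) : ∃ l, ι l = x := by
    obtain ⟨n, l, t, hn, hx, ht⟩ := exists_smul_eq_add_orthogonal BΛ BL ι hiso hLnd x
    obtain ⟨⟨p, q⟩, hpq, -⟩ := hbasis t ht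
    have hlc : BΛ (ι l) c = 0 := by rw [hsymm, hc]
    have hld : BΛ (ι l) d = 0 := by rw [hsymm, hd]
    have h1 := congrArg (fun z => BΛ z c) hx
    have h2 := congrArg (fun z => BΛ z d) hx
    simp [hpq, hxc, hxd, hlc, hld, hcc, hdd, hcd, hdc] at h1 h2
    obtain rfl : p = 0 := by omega
    obtain rfl : q = 0 := by omega
    exact hprim x n hn ⟨l, by simp [hx, hpq]⟩
  constructor
  · ext x
    constructor
    · rintro ⟨l, hl, rfl⟩
      refine ⟨fun y hy => ?_, by rw [hsymm]; simp [hc, hd]⟩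
      obtain ⟨n, m, t, hn, hny, ht⟩ := exists_smul_eq_add_orthogonal BΛ BL ι hiso hLnd y
      obtain ⟨⟨p, q⟩, hpq, -⟩ := hbasis t ht
      have hΦt (z : L) : BΛ (Φ t) (ι z) = 0 := by simp [hpq, hΦc, hΦd, hc, hd]
      have hfix : ι (φ m) + Φ t = ι m + t := by
        rw [← hrest, ← map_add, ← hny, map_zsmul, hy]
      have hm : φ m - m = 0 := hLnd _ fun z => by
        have h := congrArg (fun w => BΛ w (ι z)) hfix
        simp only [map_add, LinearMap.add_apply, hΦt, ht, hiso, add_zero] at h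
        simp [h]
      have h : n * BΛ (ι l) y = 0 := by
        rw [← smul_eq_mul, ← map_zsmul, hny, map_add, hiso, hl m (sub_eq_zero.mp hm), hsymm, ht,
          add_zero]
      exact (mul_eq_zero.mp h).resolve_left hn
    · rintro ⟨hx, hxs⟩
      have h := hx (c + d) (by rw [map_add, hΦc, hΦd, add_comm])
      rw [map_add] at h
      rw [map_sub] at hxs
      obtain ⟨l, rfl⟩ := mem_range (x := x) (by omega) (by omega)
      exact ⟨l, fun y hy => by rw [← hiso]; exact hx _ (by rw [hrest, hy]), rfl⟩
  · ext x
    constructor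
    · rintro ⟨l, hl, rfl⟩
      exact ⟨by rw [hrest, hl], by rw [hsymm]; simp [hc, hd]⟩
    · rintro ⟨hx, hxs⟩
      have h := hΦ x c
      rw [hx, hΦc] at h
      rw [map_add] at hxs
      obtain ⟨l, rfl⟩ := mem_range (x := x) (by omega) (by omega)
      exact ⟨l, hinj (by rw [← hrest, hx]), rfl⟩
end

section
/- Let A and B be the rank-2 positive-definite lattices on ℤ² with Gram matrices [[12,1],[1,2]] and [[6,1],[1,4]] respectively, and let U be the hyperbolic plane. Then the lattices U ⊕ A and U ⊕ B are isometric, but A and B are not isometric. -/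
open Matrix

/-- Gram matrix of the hyperbolic plane `U`. -/
def gramU : Matrix (Fin 2) (Fin 2) ℤ := !![0, 1; 1, 0]

/-- Gram matrix of the rank-2 positive-definite lattice `A`. -/
def gramA : Matrix (Fin 2) (Fin 2) ℤ := !![12, 1; 1, 2]

/-- Gram matrix of the rank-2 positive-definite lattice `B`. -/
def gramB : Matrix (Fin 2) (Fin 2) ℤ := !![6, 1; 1, 4]

/-- Gram matrix of `U ⊕ A`. -/
def gramUA : Matrix (Fin 2 ⊕ Fin 2) (Fin 2 ⊕ Fin 2) ℤ :=
  Matrix.fromBlocks gramU 0 0 gramA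

/-- Gram matrix of `U ⊕ B`. -/
def gramUB : Matrix (Fin 2 ⊕ Fin 2) (Fin 2 ⊕ Fin 2) ℤ :=
  Matrix.fromBlocks gramU 0 0 gramB

/-- The columns form a basis of `U ⊕ B` with Gram matrix that of `U ⊕ A`. -/
def isometryMatrix : Matrix (Fin 2 ⊕ Fin 2) (Fin 2 ⊕ Fin 2) ℤ :=
  Matrix.fromBlocks !![2, -3; -3, 2] !![-11, 1; 11, -1] !![1, -1; 1, -1] !![-5, 0; -4, 1]

/-- The inverse of `isometryMatrix`. -/
def isometryMatrixInv : Matrix (Fin 2 ⊕ Fin 2) (Fin 2 ⊕ Fin 2) ℤ :=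
  Matrix.fromBlocks !![2, -3; -3, 2] !![-7, -5; 7, 5] !![1, -1; -1, 1] !![-3, -2; 2, 3]

theorem isometryMatrix_mul_inv : isometryMatrix * isometryMatrixInv = 1 := by decide

theorem isometryMatrixInv_mul : isometryMatrixInv * isometryMatrix = 1 := by decide

theorem isometryMatrix_transpose_mul_gramUB_mul :
    isometryMatrixᵀ * (gramUB * isometryMatrix) = gramUA := by decide

theorem gramB_form_ne_two (v : Fin 2 → ℤ) : v ⬝ᵥ gramB.mulVec v ≠ 2 := by
  intro h
  simp only [gramB, dotProduct, mulVec, Fin.sum_univ_two, of_apply, cons_val', cons_val_zero,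
    cons_val_one, cons_val_fin_one] at h
  have hx : v 0 = 0 := by
    have h_lt : v 0 < 1 := by nlinarith [sq_nonneg (v 0 + 4 * v 1)]
    have h_gt : -1 < v 0 := by nlinarith [sq_nonneg (v 0 + 4 * v 1)]
    omega
  rw [hx] at h
  ring_nf at h
  omega

/-- The lattices `U ⊕ A` and `U ⊕ B` are isometric, but `A` and `B` are
not isometric, where `A`, `B` are the rank-2 positive-definite lattices with Gram matrices
`[[12,1],[1,2]]` and `[[6,1],[1,4]]`. -/
theorem stmt_5 :
    (∃ e : ((Fin 2 ⊕ Fin 2) → ℤ) ≃ₗ[ℤ] ((Fin 2 ⊕ Fin 2) → ℤ),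
      ∀ v w, e v ⬝ᵥ gramUB.mulVec (e w) = v ⬝ᵥ gramUA.mulVec w) ∧
    ¬ (∃ e : (Fin 2 → ℤ) ≃ₗ[ℤ] (Fin 2 → ℤ),
      ∀ v w, e v ⬝ᵥ gramB.mulVec (e w) = v ⬝ᵥ gramA.mulVec w) := by
  constructor
  · refine ⟨Matrix.toLin'OfInv isometryMatrixInv_mul isometryMatrix_mul_inv, fun v w => ?_⟩
    change isometryMatrix *ᵥ v ⬝ᵥ gramUB *ᵥ (isometryMatrix *ᵥ w) = _
    rw [← isometryMatrix_transpose_mul_gramUB_mul, ← mulVec_mulVec, ← mulVec_mulVec,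
      dotProduct_mulVec v, vecMul_transpose]
  · rintro ⟨e, he⟩
    refine gramB_form_ne_two (e ![0, 1]) ((he _ _).trans ?_)
    decide
end

section
/- Let M be a unimodular lattice, let g be an isometry of M, and let η ∈ M be a primitive vector with (η,η) ≠ 0 and g(η) = η. Set F = η^⊥ = {x ∈ M : (x,η)=0}. Then g restricts to an isometry of F, and this restriction acts trivially on the discriminant group A_F, i.e. for every x ∈ F⊗ℚ with (x,y) ∈ ℤ for all y ∈ F, one has g(x) − x ∈ F (g extended ℚ-linearly). -/
open TensorProduct

/-- Integer multiples in the second factor of `ℚ ⊗ M` are rational multiples. -/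
theorem one_tmul_zsmul {M : Type*} [AddCommGroup M] [Module ℤ M] (j : ℤ) (v : M) :
    (1 : ℚ) ⊗ₜ[ℤ] (j • v) = (j : ℚ) • ((1 : ℚ) ⊗ₜ[ℤ] v) := by
  rw [Int.cast_smul_eq_zsmul]
  exact map_zsmul (TensorProduct.mk ℤ ℚ M 1) j v

/-- Every element of `ℚ ⊗ M` has a nonzero integral multiple coming from `M`. -/
theorem exists_smul_eq_one_tmul {M : Type*} [AddCommGroup M] [Module ℤ M] (t : ℚ ⊗[ℤ] M) :
    ∃ n : ℤ, n ≠ 0 ∧ ∃ y : M, (n : ℚ) • t = (1 : ℚ) ⊗ₜ[ℤ] y := by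
  induction t using TensorProduct.induction_on with
  | zero => exact ⟨1, one_ne_zero, 0, by simp⟩
  | tmul q m =>
    refine ⟨q.den, by exact_mod_cast q.den_ne_zero, q.num • m, ?_⟩
    rw [one_tmul_zsmul, TensorProduct.smul_tmul', TensorProduct.smul_tmul']
    congr 1
    simp [Rat.den_mul_eq_num]
  | add a b ha hb =>
    obtain ⟨n, hn, y, hy⟩ := ha
    obtain ⟨k, hk, z, hz⟩ := hb
    refine ⟨n * k, mul_ne_zero hn hk, k • y + n • z, ?_⟩
    rw [TensorProduct.tmul_add, one_tmul_zsmul, one_tmul_zsmul, ← hy, ← hz]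
    push_cast
    module

/-- A vector of `ℚ ⊗ M` orthogonal to all of `M` vanishes when the form on `M` is
nondegenerate. -/
theorem eq_zero_of_baseChange_eq_zero {M : Type*} [AddCommGroup M] [Module ℤ M]
    (B : LinearMap.BilinForm ℤ M) (hnd : ∀ x, (∀ y, B x y = 0) → x = 0) (t : ℚ ⊗[ℤ] M)
    (ht : ∀ y : M, LinearMap.BilinForm.baseChange ℚ B t ((1 : ℚ) ⊗ₜ[ℤ] y) = 0) : t = 0 := by
  obtain ⟨n, hn, y, hy⟩ := exists_smul_eq_one_tmul t
  have hy0 : y = 0 := by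
    refine hnd y fun z => ?_
    have h : LinearMap.BilinForm.baseChange ℚ B ((n : ℚ) • t) ((1 : ℚ) ⊗ₜ[ℤ] z) = 0 := by
      rw [map_smul, LinearMap.smul_apply, ht, smul_zero]
    rw [hy] at h
    simpa using h
  rw [hy0, TensorProduct.tmul_zero] at hy
  exact (smul_eq_zero.mp hy).resolve_left (by exact_mod_cast hn)

/-- The kernel of an integral linear form is the image of a projection. -/
theorem exists_projection_ker {M : Type*} [AddCommGroup M] [Module ℤ M] (f : M →ₗ[ℤ] ℤ) :
    ∃ p : M →ₗ[ℤ] M, (∀ y, f (p y) = 0) ∧ ∀ y, f y = 0 → p y = y := by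
  obtain ⟨s, hs⟩ := Module.projective_lifting_property f.rangeRestrict LinearMap.id
    f.surjective_rangeRestrict
  refine ⟨LinearMap.id - s ∘ₗ f.rangeRestrict, fun y => ?_, fun y hy => ?_⟩
  · have h := congrArg Subtype.val (LinearMap.congr_fun hs (f.rangeRestrict y))
    simp only [LinearMap.comp_apply, LinearMap.codRestrict_apply, LinearMap.id_apply,
      LinearMap.rangeRestrict] at h
    simp only [LinearMap.sub_apply, LinearMap.id_apply, LinearMap.comp_apply, map_sub,
      LinearMap.rangeRestrict]
    exact sub_eq_zero.mpr h.symm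
  · have h : f.rangeRestrict y = 0 := Subtype.ext hy
    simp [h]

/-- Let `M` be a unimodular lattice, `g` an isometry of `M`, and `η ∈ M` a
primitive vector with `(η,η) ≠ 0` and `g(η) = η`. Set `F = η^⊥`. Then `g` restricts to an
isometry of `F`, and this restriction acts trivially on the discriminant group `A_F`:
for every `x ∈ F ⊗ ℚ` (viewed inside `M ⊗ ℚ`) pairing integrally with `F`, one has
`g(x) - x ∈ F` (with `g` extended ℚ-linearly). -/
theorem stmt_6
    (M : Type) [AddCommGroup M] [Module ℤ M] [Module.Free ℤ M] [Module.Finite ℤ M]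
    (B : LinearMap.BilinForm ℤ M)
    -- the form is symmetric and nondegenerate
    (hsymm : ∀ x y, B x y = B y x)
    (hnd : ∀ x, (∀ y, B x y = 0) → x = 0)
    -- M is unimodular
    (hunimod : Function.Bijective (fun x : M => B x))
    -- g is an isometry of M
    (g : M ≃ₗ[ℤ] M)
    (hg : ∀ x y, B (g x) (g y) = B x y)
    -- η is a primitive vector with (η,η) ≠ 0, fixed by g
    (η : M)
    (hηprim : ∀ (x : M) (n : ℤ), n ≠ 0 → n • x ∈ Submodule.span ℤ {η} →
      x ∈ Submodule.span ℤ {η})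
    (hηη : B η η ≠ 0)
    (hgη : g η = η)
    -- F = η^⊥
    (F : Submodule ℤ M)
    (hF : ∀ x, x ∈ F ↔ B x η = 0) :
    -- g restricts to F, and the restriction acts trivially on A_F
    (∀ x ∈ F, g x ∈ F) ∧
    (∀ x : ℚ ⊗[ℤ] M,
      x ∈ Submodule.span ℚ ((fun y : M => (1 : ℚ) ⊗ₜ[ℤ] y) '' (F : Set M)) →
      (∀ y ∈ F, ∃ n : ℤ, LinearMap.BilinForm.baseChange ℚ B x ((1 : ℚ) ⊗ₜ[ℤ] y) = (n : ℚ)) →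
      ∃ z ∈ F, LinearMap.baseChange ℚ (g : M →ₗ[ℤ] M) x - x = (1 : ℚ) ⊗ₜ[ℤ] z) := by
  have hgF : ∀ x, B (g x) η = B x η := fun x => by
    conv_lhs => rw [← hgη]
    exact hg x η
  refine ⟨fun x hx => (hF _).2 ((hgF x).trans ((hF x).1 hx)), fun x _ hx => ?_⟩
  obtain ⟨p, hp, hpF⟩ := exists_projection_ker (B.flip η)
  choose φ hφ using fun y : M => hx (p y) ((hF _).2 (hp y))
  let φl : M →ₗ[ℤ] ℤ :=
    { toFun := φ
      map_add' := fun a b => by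
        have h := hφ (a + b)
        rw [map_add, TensorProduct.tmul_add, map_add, hφ, hφ] at h
        exact_mod_cast h.symm
      map_smul' := fun k a => by
        have h := hφ (k • a)
        rw [map_zsmul, one_tmul_zsmul, map_smul, hφ, smul_eq_mul] at h
        refine (congrArg φ (int_smul_eq_zsmul _ k a)).trans ?_
        rw [RingHom.id_apply, smul_eq_mul]
        exact_mod_cast h.symm }
  obtain ⟨m, hm⟩ := hunimod.2 φl
  have hm' : ∀ y, B m y = φ y := fun y => LinearMap.congr_fun hm y
  set Bq := LinearMap.BilinForm.baseChange ℚ B with hBq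
  have hB1 : ∀ a b : M, Bq ((1 : ℚ) ⊗ₜ[ℤ] a) ((1 : ℚ) ⊗ₜ[ℤ] b) = (B a b : ℚ) := fun a b => by
    simp [hBq]
  have hηq : (B η η : ℚ) ≠ 0 := by exact_mod_cast hηη
  obtain ⟨w, hw⟩ : ∃ w, w = x - (1 : ℚ) ⊗ₜ[ℤ] m := ⟨_, rfl⟩
  have hwF : ∀ y ∈ F, Bq w ((1 : ℚ) ⊗ₜ[ℤ] y) = 0 := fun y hy => by
    have h := hφ y
    rw [hpF y ((hF y).1 hy)] at h
    rw [hw, map_sub, LinearMap.sub_apply, h, hB1, hm', sub_self]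
  obtain ⟨c, hc⟩ : ∃ c : ℚ, c = Bq w ((1 : ℚ) ⊗ₜ[ℤ] η) / (B η η : ℚ) := ⟨_, rfl⟩
  have hwη : w = c • ((1 : ℚ) ⊗ₜ[ℤ] η) := by
    refine sub_eq_zero.mp (eq_zero_of_baseChange_eq_zero B hnd _ fun y => ?_)
    have hy : B η η • y - B y η • η ∈ F := by
      rw [hF]
      simp [mul_comm]
    have h := hwF _ hy
    rw [TensorProduct.tmul_sub, one_tmul_zsmul, one_tmul_zsmul, map_sub,
      map_smul, map_smul, smul_eq_mul, smul_eq_mul] at h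
    rw [← hBq, map_sub, LinearMap.sub_apply, map_smul, LinearMap.smul_apply, hB1, hc,
      smul_eq_mul, hsymm η y]
    field_simp
    linear_combination h
  refine ⟨g m - m, (hF _).2 (by rw [map_sub, LinearMap.sub_apply, hgF, sub_self]), ?_⟩
  have hxe : x = (1 : ℚ) ⊗ₜ[ℤ] m + c • ((1 : ℚ) ⊗ₜ[ℤ] η) := by
    rw [← hwη, hw]
    abel
  rw [hxe, map_add, map_smul, LinearMap.baseChange_tmul, LinearMap.baseChange_tmul,
    LinearEquiv.coe_coe, hgη, TensorProduct.tmul_sub]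
  abel
end

section
/- There exists a primitive isometric embedding of the rank-14 lattice (U ⊕ U(3) ⊕ A2^{⊕5})(−1) into the K3 lattice U^{⊕3} ⊕ E8(−1)^{⊕2}. -/
open Matrix

/-- Gram matrix of `U(3)`. -/
def gramU3 : Matrix (Fin 2) (Fin 2) ℤ := !![0, 3; 3, 0]

/-- Gram matrix of the root lattice `A₂`. -/
def gramA2 : Matrix (Fin 2) (Fin 2) ℤ := !![2, -1; -1, 2]

/-- Gram matrix of the root lattice `E₈` (standard Cartan matrix, Bourbaki numbering). -/
def gramE8 : Matrix (Fin 8) (Fin 8) ℤ :=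
  !![ 2,  0, -1,  0,  0,  0,  0,  0;
      0,  2,  0, -1,  0,  0,  0,  0;
     -1,  0,  2, -1,  0,  0,  0,  0;
      0, -1, -1,  2, -1,  0,  0,  0;
      0,  0,  0, -1,  2, -1,  0,  0;
      0,  0,  0,  0, -1,  2, -1,  0;
      0,  0,  0,  0,  0, -1,  2, -1;
      0,  0,  0,  0,  0,  0, -1,  2]

/-- Rank-22 index type for the K3 lattice `U^{⊕3} ⊕ E₈(-1)^{⊕2}`. -/
abbrev IK3 : Type := (Fin 2 ⊕ Fin 2) ⊕ (Fin 2 ⊕ (Fin 8 ⊕ Fin 8))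

/-- Gram matrix of the K3 lattice `U^{⊕3} ⊕ E₈(-1)^{⊕2}`. -/
def gramK3 : Matrix IK3 IK3 ℤ :=
  Matrix.fromBlocks (Matrix.fromBlocks gramU 0 0 gramU) 0 0
    (Matrix.fromBlocks gramU 0 0
      (Matrix.fromBlocks (-gramE8) 0 0 (-gramE8)))

/-- Rank-14 index type for the lattice `(U ⊕ U(3) ⊕ A₂^{⊕5})(-1)`. -/
abbrev ISrc : Type :=
  (Fin 2 ⊕ Fin 2) ⊕ (Fin 2 ⊕ (Fin 2 ⊕ (Fin 2 ⊕ (Fin 2 ⊕ Fin 2))))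

/-- Gram matrix of the lattice `(U ⊕ U(3) ⊕ A₂^{⊕5})(-1)`. -/
def gramSrc : Matrix ISrc ISrc ℤ :=
  - (Matrix.fromBlocks (Matrix.fromBlocks gramU 0 0 gramU3) 0 0
      (Matrix.fromBlocks gramA2 0 0
        (Matrix.fromBlocks gramA2 0 0
          (Matrix.fromBlocks gramA2 0 0 (Matrix.fromBlocks gramA2 0 0 gramA2)))))

/-- The rows are the images in the K3 lattice of the standard basis of
`(U ⊕ U(3) ⊕ A₂^{⊕5})(-1)`. Each `E₈` contains `A₂^{⊕4}`: two summands are images of copies of `A₂`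
and the remaining vectors involve only roots of the other two. -/
def basisImages : Matrix ISrc IK3 ℤ :=
  Sum.elim (Sum.elim
    ![Sum.elim (Sum.elim ![1, 0] 0) (Sum.elim 0 (Sum.elim 0 0)),
      Sum.elim (Sum.elim ![0, -1] 0) (Sum.elim 0 (Sum.elim 0 0))]
    ![Sum.elim (Sum.elim 0 ![1, 0]) (Sum.elim 0 (Sum.elim 0 0)),
      Sum.elim (Sum.elim 0 ![-1, -3]) (Sum.elim 0
        (Sum.elim ![-1, -1, -2, -2, -1, 0, 0, 0] ![-2, -1, -2, -2, -1, 0, 0, 0]))])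
    (Sum.elim
    ![Sum.elim (Sum.elim 0 0) (Sum.elim ![1, -1] (Sum.elim 0 0)),
      Sum.elim (Sum.elim 0 0) (Sum.elim ![0, 1] (Sum.elim ![1, 0, 0, 0, 0, 0, 0, 0] 0))]
    (Sum.elim
    ![Sum.elim (Sum.elim 0 0) (Sum.elim 0 (Sum.elim ![0, 0, 0, 0, 0, 0, 1, 0] 0)),
      Sum.elim (Sum.elim 0 0) (Sum.elim 0 (Sum.elim ![0, 0, 0, 0, 0, 0, 0, 1] 0))]
    (Sum.elim
    ![Sum.elim (Sum.elim 0 0) (Sum.elim 0 (Sum.elim ![0, 1, 0, 0, 0, 0, 0, 0] 0)),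
      Sum.elim (Sum.elim 0 0) (Sum.elim 0 (Sum.elim ![0, 0, 0, 1, 0, 0, 0, 0] 0))]
    (Sum.elim
    ![Sum.elim (Sum.elim 0 0) (Sum.elim 0 (Sum.elim 0 ![0, 0, 0, 0, 0, 0, 1, 0])),
      Sum.elim (Sum.elim 0 0) (Sum.elim 0 (Sum.elim 0 ![0, 0, 0, 0, 0, 0, 0, 1]))]
    ![Sum.elim (Sum.elim 0 0) (Sum.elim 0 (Sum.elim 0 ![0, 1, 0, 0, 0, 0, 0, 0])),
      Sum.elim (Sum.elim 0 0) (Sum.elim 0 (Sum.elim 0 ![0, 0, 0, 1, 0, 0, 0, 0]))]))))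

/-- An integral left inverse of `basisImagesᵀ`, witnessing primitivity. -/
def dualFunctionals : Matrix ISrc IK3 ℤ :=
  Sum.elim (Sum.elim
    ![Sum.elim (Sum.elim ![1, 0] 0) (Sum.elim 0 (Sum.elim 0 0)),
      Sum.elim (Sum.elim ![0, -1] 0) (Sum.elim 0 (Sum.elim 0 0))]
    ![Sum.elim (Sum.elim 0 ![1, 0]) (Sum.elim ![1, 1] (Sum.elim ![-1, 0, 0, 0, 0, 0, 0, 0] 0)),
      Sum.elim (Sum.elim 0 0) (Sum.elim ![1, 1] (Sum.elim ![-1, 0, 0, 0, 0, 0, 0, 0] 0))])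
    (Sum.elim
    ![Sum.elim (Sum.elim 0 0) (Sum.elim ![1, 0] (Sum.elim 0 0)),
      Sum.elim (Sum.elim 0 0) (Sum.elim ![1, 1] (Sum.elim 0 0))]
    (Sum.elim
    ![Sum.elim (Sum.elim 0 0) (Sum.elim 0 (Sum.elim ![0, 0, 0, 0, 0, 0, 1, 0] 0)),
      Sum.elim (Sum.elim 0 0) (Sum.elim 0 (Sum.elim ![0, 0, 0, 0, 0, 0, 0, 1] 0))]
    (Sum.elim
    ![Sum.elim (Sum.elim 0 0) (Sum.elim ![1, 1] (Sum.elim ![-1, 1, 0, 0, 0, 0, 0, 0] 0)),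
      Sum.elim (Sum.elim 0 0) (Sum.elim ![2, 2] (Sum.elim ![-2, 0, 0, 1, 0, 0, 0, 0] 0))]
    (Sum.elim
    ![Sum.elim (Sum.elim 0 0) (Sum.elim 0 (Sum.elim 0 ![0, 0, 0, 0, 0, 0, 1, 0])),
      Sum.elim (Sum.elim 0 0) (Sum.elim 0 (Sum.elim 0 ![0, 0, 0, 0, 0, 0, 0, 1]))]
    ![Sum.elim (Sum.elim 0 0) (Sum.elim ![1, 1]
        (Sum.elim ![-1, 0, 0, 0, 0, 0, 0, 0] ![0, 1, 0, 0, 0, 0, 0, 0])),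
      Sum.elim (Sum.elim 0 0) (Sum.elim ![2, 2]
        (Sum.elim ![-2, 0, 0, 0, 0, 0, 0, 0] ![0, 0, 0, 1, 0, 0, 0, 0]))]))))

lemma basisImages_gram : basisImages * gramK3 * basisImagesᵀ = gramSrc := by
  decide +kernel

lemma dualFunctionals_mul_basisImages_transpose : dualFunctionals * basisImagesᵀ = 1 := by
  decide +kernel

/-- An integral matrix with an integral left inverse has torsion-free cokernel. -/
lemma mem_range_mulVecLin_of_smul_mem {m n : Type*} [Fintype m] [Fintype n] [DecidableEq n]
    {A : Matrix m n ℤ} {L : Matrix n m ℤ} (h : L * A = 1) {x : m → ℤ} {k : ℤ} (hk : k ≠ 0)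
    (hx : k • x ∈ LinearMap.range A.mulVecLin) : x ∈ LinearMap.range A.mulVecLin := by
  obtain ⟨y, hy⟩ := hx
  rw [mulVecLin_apply] at hy
  refine ⟨L *ᵥ x, smul_right_injective _ hk ?_⟩
  have hy' : y = k • L *ᵥ x := by
    rw [← mulVec_smul, ← hy, mulVec_mulVec, h, one_mulVec]
  simp only [mulVecLin_apply]
  rw [← mulVec_smul, ← hy', hy]

/-- There is a primitive isometric embedding of the rank-14 lattice
`(U ⊕ U(3) ⊕ A₂^{⊕5})(-1)` into the K3 lattice `U^{⊕3} ⊕ E₈(-1)^{⊕2}`. -/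
theorem stmt_10 :
    ∃ f : (ISrc → ℤ) →ₗ[ℤ] (IK3 → ℤ),
      Function.Injective f ∧
      (∀ v w : ISrc → ℤ, f v ⬝ᵥ gramK3.mulVec (f w) = v ⬝ᵥ gramSrc.mulVec w) ∧
      -- primitivity: the cokernel of f is torsion-free
      (∀ (x : IK3 → ℤ) (n : ℤ), n ≠ 0 → n • x ∈ LinearMap.range f →
        x ∈ LinearMap.range f) := by
  refine ⟨basisImagesᵀ.mulVecLin,
    Function.LeftInverse.injective (g := dualFunctionals.mulVec) fun v => by
      rw [mulVecLin_apply, mulVec_mulVec, dualFunctionals_mul_basisImages_transpose, one_mulVec],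
    fun v w => ?_,
    fun x n hn hx =>
      mem_range_mulVecLin_of_smul_mem dualFunctionals_mul_basisImages_transpose hn hx⟩
  rw [mulVecLin_apply, mulVecLin_apply, mulVec_mulVec, mulVec_transpose, ← dotProduct_mulVec,
    mulVec_mulVec, ← Matrix.mul_assoc, basisImages_gram]
end

section
/- Let A be the lattice ℤ^7 with symmetric bilinear form given by the block-diagonal Gram matrix G = [3] ⊕ G₆, where G₆ is the 6×6 matrix with rows [4,2,−1,1,2,−2], [2,4,1,2,1,−1], [−1,1,4,2,−2,−1], [1,2,2,4,−1,−2], [2,1,−2,−1,4,−1], [−2,−1,−1,−2,−1,4], and let η = e₁ (so (η,η)=3). Then for every w ∈ ℤ^7 the integer 3·(w,w) − (η,w)² is divisible by 6; consequently, for every rank-2 sublattice of A containing η, the determinant of the Gram matrix of any ℤ-basis of that sublattice is divisible by 6. -/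
open Matrix

/-- Gram matrix `[3] ⊕ G₆` of the rank-7 lattice `A`. -/
def gramA7 : Matrix (Fin 7) (Fin 7) ℤ :=
  !![3,  0,  0,  0,  0,  0,  0;
     0,  4,  2, -1,  1,  2, -2;
     0,  2,  4,  1,  2,  1, -1;
     0, -1,  1,  4,  2, -2, -1;
     0,  1,  2,  2,  4, -1, -2;
     0,  2,  1, -2, -1,  4, -1;
     0, -2, -1, -1, -2, -1,  4]

/-- The vector `η = e₁`, of square 3. -/
def η : Fin 7 → ℤ := fun i => if i = 0 then 1 else 0

theorem gramA7_dotProduct_comm (u v : Fin 7 → ℤ) :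
    v ⬝ᵥ gramA7.mulVec u = u ⬝ᵥ gramA7.mulVec v := by
  have hsymm : gramA7ᵀ = gramA7 := by decide
  rw [dotProduct_mulVec, ← mulVec_transpose, hsymm, dotProduct_comm]

theorem six_dvd_three_mul_sub_sq (w : Fin 7 → ℤ) :
    (6 : ℤ) ∣ 3 * (w ⬝ᵥ gramA7.mulVec w) - (η ⬝ᵥ gramA7.mulVec w) ^ 2 := by
  refine ⟨2 * w 1 ^ 2 + 2 * w 1 * w 2 - w 1 * w 3 + w 1 * w 4 + 2 * w 1 * w 5 - 2 * w 1 * w 6 +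
    2 * w 2 ^ 2 + w 2 * w 3 + 2 * w 2 * w 4 + w 2 * w 5 - w 2 * w 6 +
    2 * w 3 ^ 2 + 2 * w 3 * w 4 - 2 * w 3 * w 5 - w 3 * w 6 +
    2 * w 4 ^ 2 - w 4 * w 5 - 2 * w 4 * w 6 +
    2 * w 5 ^ 2 - w 5 * w 6 +
    2 * w 6 ^ 2, ?_⟩
  simp [dotProduct, mulVec, gramA7, η, Fin.sum_univ_succ]
  ring

/-- The Gram determinant of `(u, v)` is unchanged by a unimodular change of basis. -/
theorem gram_det_of_unimodular (u v : Fin 7 → ℤ) {a b c d : ℤ} (h : a * d - b * c = 1) :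
    (u ⬝ᵥ gramA7.mulVec u) * (v ⬝ᵥ gramA7.mulVec v) - (u ⬝ᵥ gramA7.mulVec v) ^ 2 =
      ((a • u + b • v) ⬝ᵥ gramA7.mulVec (a • u + b • v)) *
          ((c • u + d • v) ⬝ᵥ gramA7.mulVec (c • u + d • v)) -
        ((a • u + b • v) ⬝ᵥ gramA7.mulVec (c • u + d • v)) ^ 2 := by
  simp only [mulVec_add, mulVec_smul, dotProduct_add, add_dotProduct, smul_dotProduct,
    dotProduct_smul, smul_eq_mul, gramA7_dotProduct_comm u v]
  generalize u ⬝ᵥ gramA7.mulVec u = P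
  generalize v ⬝ᵥ gramA7.mulVec v = Q
  generalize u ⬝ᵥ gramA7.mulVec v = R
  linear_combination (-(P * Q - R ^ 2) * (a * d - b * c + 1)) * h

/-- In the lattice `A = (ℤ⁷, [3] ⊕ G₆)` with `η = e₁`:
for every `w` the integer `3·(w,w) − (η,w)²` is divisible by 6; consequently, the
determinant of the Gram matrix of any ℤ-basis `(u,v)` of a rank-2 sublattice containing `η`
is divisible by 6. -/
theorem stmt_12 :
    (∀ w : Fin 7 → ℤ,
      (6 : ℤ) ∣ (3 * (w ⬝ᵥ gramA7.mulVec w) - (η ⬝ᵥ gramA7.mulVec w) ^ 2)) ∧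
    (∀ u v : Fin 7 → ℤ, LinearIndependent ℤ ![u, v] →
      η ∈ Submodule.span ℤ {u, v} →
      (6 : ℤ) ∣ ((u ⬝ᵥ gramA7.mulVec u) * (v ⬝ᵥ gramA7.mulVec v)
        - (u ⬝ᵥ gramA7.mulVec v) ^ 2)) := by
  refine ⟨six_dvd_three_mul_sub_sq, fun u v _ hη => ?_⟩
  obtain ⟨a, b, hab⟩ := Submodule.mem_span_pair.mp hη
  have hunit : a * u 0 - b * (-v 0) = 1 := by
    have h0 := congrFun hab 0
    simp only [η, Pi.add_apply, Pi.smul_apply, smul_eq_mul, if_true] at h0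
    linarith
  have hηη : η ⬝ᵥ gramA7.mulVec η = 3 := by decide
  rw [gram_det_of_unimodular u v hunit, hab, hηη]
  exact six_dvd_three_mul_sub_sq _
end

section
/- Let L be the lattice ℤ^6 with the positive-definite symmetric bilinear form given by the Gram matrix G₆ with rows [4,2,−1,1,2,−2], [2,4,1,2,1,−1], [−1,1,4,2,−2,−1], [1,2,2,4,−1,−2], [2,1,−2,−1,4,−1], [−2,−1,−1,−2,−1,4]. Then: (i) L contains no vector v with (v,v) = 2; (ii) the set of vectors v ∈ L with (v,v) = 4 is finite and has exactly 54 elements; (iii) these 54 vectors of square 4 generate L as a ℤ-module. -/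
open Matrix

/-- Gram matrix `G₆` of the rank-6 positive-definite lattice `L`. -/
def gramL6 : Matrix (Fin 6) (Fin 6) ℤ :=
  !![ 4,  2, -1,  1,  2, -2;
      2,  4,  1,  2,  1, -1;
     -1,  1,  4,  2, -2, -1;
      1,  2,  2,  4, -1, -2;
      2,  1, -2, -1,  4, -1;
     -2, -1, -1, -2, -1,  4]

/-- The diagonal entries of `G₆⁻¹` are all `2 / 3`, so by Cauchy-Schwarz each coordinate of a
vector is bounded by its square. The proofs exhibit the difference as a sum of squares. -/
lemma three_mul_sq_le_gramL6 (v : Fin 6 → ℤ) (i : Fin 6) :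
    3 * v i ^ 2 ≤ 2 * (v ⬝ᵥ gramL6.mulVec v) := by
  simp only [gramL6, mulVec, dotProduct, Fin.sum_univ_six, of_apply, cons_val]
  fin_cases i <;> dsimp only [Fin.reduceFinMk, Fin.zero_eta, Fin.mk_one]
  · nlinarith [sq_nonneg (2 * v 0 + 4 * v 1 + v 2 + 2 * v 3 + v 4 - v 5),
      sq_nonneg (-2 * v 0 + 5 * v 2 + 2 * v 3 - 3 * v 4 - v 5),
      sq_nonneg (v 0 + 4 * v 3 - v 4 - 2 * v 5), sq_nonneg (v 0 + 3 * v 4 - 2 * v 5),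
      sq_nonneg (-v 0 + 2 * v 5)]
  · nlinarith [sq_nonneg (4 * v 0 + 2 * v 1 - v 2 + v 3 + 2 * v 4 - 2 * v 5),
      sq_nonneg (2 * v 1 + 5 * v 2 + 3 * v 3 - 2 * v 4 - 2 * v 5),
      sq_nonneg (v 1 + 4 * v 3 - v 4 - v 5), sq_nonneg (v 1 + 3 * v 4 - v 5),
      sq_nonneg (v 1 + 2 * v 5)]
  · nlinarith [sq_nonneg (4 * v 0 + 2 * v 1 - v 2 + v 3 + 2 * v 4 - 2 * v 5),
      sq_nonneg (2 * v 1 + v 2 + v 3),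
      sq_nonneg (v 2 + 2 * v 3 - v 4 - v 5), sq_nonneg (-v 2 + 3 * v 4 - v 5),
      sq_nonneg (-v 2 + 2 * v 5)]
  · nlinarith [sq_nonneg (4 * v 0 + 2 * v 1 - v 2 + v 3 + 2 * v 4 - 2 * v 5),
      sq_nonneg (2 * v 1 + v 2 + v 3),
      sq_nonneg (2 * v 2 + v 3 - v 4 - v 5), sq_nonneg (-v 3 + 3 * v 4 - v 5),
      sq_nonneg (-v 3 + 2 * v 5)]
  · nlinarith [sq_nonneg (4 * v 0 + 2 * v 1 - v 2 + v 3 + 2 * v 4 - 2 * v 5),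
      sq_nonneg (2 * v 1 + v 2 + v 3),
      sq_nonneg (2 * v 2 + v 3 - v 4 - v 5), sq_nonneg (3 * v 3 - v 4 - v 5),
      sq_nonneg (-v 4 + 2 * v 5)]
  · nlinarith [sq_nonneg (4 * v 0 + 2 * v 1 - v 2 + v 3 + 2 * v 4 - 2 * v 5),
      sq_nonneg (2 * v 1 + v 2 + v 3),
      sq_nonneg (2 * v 2 + v 3 - v 4 - v 5), sq_nonneg (3 * v 3 - v 4 - v 5),
      sq_nonneg (2 * v 4 - v 5)]

/-- The form `G₆` as a polynomial in the coordinates, arranged for fast evaluation. -/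
def quadL6 (a b c d e f : ℤ) : ℤ :=
  4 * (a * a + b * b + c * c + d * d + e * e + f * f) +
    2 * (a * (2 * b - c + d + 2 * e - 2 * f) + b * (c + 2 * d + e - f) +
      c * (2 * d - 2 * e - f) - d * (e + 2 * f) - e * f)

lemma gramL6_eq_quadL6 (v : Fin 6 → ℤ) :
    v ⬝ᵥ gramL6.mulVec v = quadL6 (v 0) (v 1) (v 2) (v 3) (v 4) (v 5) := by
  simp only [gramL6, quadL6, mulVec, dotProduct, Fin.sum_univ_six, of_apply, cons_val]
  ring

/-- The possible coordinates of a vector of square at most `4`. -/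
def coordL6 : Finset ℤ := {-1, 0, 1}

lemma apply_mem_coordL6 {v : Fin 6 → ℤ} (hv : v ⬝ᵥ gramL6.mulVec v ≤ 4) (i : Fin 6) :
    v i ∈ coordL6 := by
  have h := three_mul_sq_le_gramL6 v i
  have hlower : -1 ≤ v i := by nlinarith
  have hupper : v i ≤ 1 := by nlinarith
  simp only [coordL6, Finset.mem_insert, Finset.mem_singleton]
  lia

/-- The vectors of square `4`, as coordinate tuples. -/
def minimalL6 : Finset (ℤ × ℤ × ℤ × ℤ × ℤ × ℤ) :=
  (coordL6 ×ˢ coordL6 ×ˢ coordL6 ×ˢ coordL6 ×ˢ coordL6 ×ˢ coordL6).filter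
    fun (a, b, c, d, e, f) => quadL6 a b c d e f = 4

/-- The vector with a given tuple of coordinates. -/
def vecOfTuple : ℤ × ℤ × ℤ × ℤ × ℤ × ℤ ↪ (Fin 6 → ℤ) where
  toFun := fun (a, b, c, d, e, f) => ![a, b, c, d, e, f]
  inj' := by
    rintro ⟨a, b, c, d, e, f⟩ ⟨a', b', c', d', e', f'⟩ h
    simpa using h

lemma coe_map_minimalL6 :
    (minimalL6.map vecOfTuple : Set (Fin 6 → ℤ)) = {v | v ⬝ᵥ gramL6.mulVec v = 4} := by
  ext v
  rw [Finset.mem_coe, Finset.mem_map, Set.mem_ofPred_eq]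
  constructor
  · rintro ⟨⟨a, b, c, d, e, f⟩, h, rfl⟩
    rw [gramL6_eq_quadL6]
    exact (Finset.mem_filter.1 h).2
  · intro hv
    have hcoord := apply_mem_coordL6 hv.le
    refine ⟨(v 0, v 1, v 2, v 3, v 4, v 5), ?_, ?_⟩
    · simpa [minimalL6, hcoord] using gramL6_eq_quadL6 v ▸ hv
    · ext i
      fin_cases i <;> rfl

/-- In the lattice `L = (ℤ⁶, G₆)`:
(i) there is no vector of square 2;
(ii) there are exactly 54 vectors of square 4;
(iii) the vectors of square 4 generate `L` as a ℤ-module. -/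
theorem stmt_13 :
    (∀ v : Fin 6 → ℤ, v ⬝ᵥ gramL6.mulVec v ≠ 2) ∧
    ({v : Fin 6 → ℤ | v ⬝ᵥ gramL6.mulVec v = 4}.Finite ∧
      {v : Fin 6 → ℤ | v ⬝ᵥ gramL6.mulVec v = 4}.ncard = 54) ∧
    Submodule.span ℤ {v : Fin 6 → ℤ | v ⬝ᵥ gramL6.mulVec v = 4} = ⊤ := by
  refine ⟨fun v hv => ?_, ⟨?_, ?_⟩, ?_⟩
  · have hbox : ∀ a ∈ coordL6, ∀ b ∈ coordL6, ∀ c ∈ coordL6, ∀ d ∈ coordL6,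
        ∀ e ∈ coordL6, ∀ f ∈ coordL6, quadL6 a b c d e f ≠ 2 := by decide +kernel
    have hcoord := apply_mem_coordL6 (hv.trans_le (by norm_num))
    exact hbox _ (hcoord 0) _ (hcoord 1) _ (hcoord 2) _ (hcoord 3) _ (hcoord 4) _ (hcoord 5)
      (gramL6_eq_quadL6 v ▸ hv)
  · exact coe_map_minimalL6 ▸ Finset.finite_toSet _
  · rw [← coe_map_minimalL6, Set.ncard_coe_finset, Finset.card_map]
    decide +kernel
  · rw [eq_top_iff, ← (Pi.basisFun ℤ (Fin 6)).span_eq]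
    refine Submodule.span_mono ?_
    rintro _ ⟨i, rfl⟩
    rw [Pi.basisFun_apply, Set.mem_ofPred_eq]
    revert i
    decide +kernel
end
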